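/- (Region F) Let F be the midpoint of segment BC, G the orthogonal projection of C onto line AB, and θ = ∠ B A C. The circular segment of the circle with center F and radius a/2 cut off by the chord BG, on the side of line AB opposite to C — that is, the set of points x with dist x F ≤ a/2 lying on the opposite side of the line through A and B from C — has two-dimensional Lebesgue measure a^2·θ/4 − a^3·b/(4·c^2). -/

import Mathlib

open EuclideanGeometry MeasureTheory

/-- If an affine subspace is the zero set of a real affine map, two points lie strictly on opposite
sides of it exactly when the map takes values of opposite signs at them. -/
theorem AffineSubspace.sOppSide_iff_mul_neg_of_mem_iff {V P : Type*} [AddCommGroup V] [Module ℝ V]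
    [AddTorsor V P] {s : AffineSubspace ℝ P} (f : P →ᵃ[ℝ] ℝ) (hf : ∀ x, x ∈ s ↔ f x = 0)
    (x y : P) : s.SOppSide x y ↔ f x * f y < 0 := by
  constructor
  · intro h
    have hx : f x ≠ 0 := fun h0 => h.left_notMem ((hf x).2 h0)
    have hy : f y ≠ 0 := fun h0 => h.right_notMem ((hf y).2 h0)
    obtain ⟨p, hp, ⟨t, ⟨ht0, ht1⟩, rfl⟩, -, -⟩ := h.exists_sbtw
    rw [hf, AffineMap.apply_lineMap, AffineMap.lineMap_apply_ring'] at hp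
    have key : t * (f x * f y) = -((1 - t) * f x ^ 2) := by linear_combination f x * hp
    have hx2 : 0 < f x ^ 2 := by positivity
    have ht : 0 < t := by
      refine lt_of_le_of_ne ht0 fun h0 => hx ?_
      rw [← h0] at hp
      simpa using hp
    have ht' : t < 1 := by
      refine lt_of_le_of_ne ht1 fun h0 => hy ?_
      rw [h0] at hp
      linarith
    have : 0 < (1 - t) * f x ^ 2 := mul_pos (by linarith) hx2
    by_contra! hcon
    nlinarith [mul_nonneg ht0 hcon]
  · intro h
    have hx : f x ≠ 0 := left_ne_zero_of_mul h.ne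
    have hy : f y ≠ 0 := right_ne_zero_of_mul h.ne
    have hxy : f x - f y ≠ 0 := fun h0 => by
      rw [sub_eq_zero.1 h0] at h
      nlinarith [mul_self_nonneg (f y)]
    refine ⟨AffineSubspace.wOppSide_iff_exists_wbtw.2
      ⟨AffineMap.lineMap x y (f x / (f x - f y)), ?_, ⟨_, ⟨?_, ?_⟩, rfl⟩⟩,
      fun h0 => hx ((hf x).1 h0), fun h0 => hy ((hf y).1 h0)⟩
    · rw [hf, AffineMap.apply_lineMap, AffineMap.lineMap_apply_ring']
      field_simp
      ring
    · have : f x / (f x - f y) = f x * (f x - f y) / (f x - f y) ^ 2 := by field_simp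
      rw [this]
      exact div_nonneg (by nlinarith [sq_nonneg (f x)]) (sq_nonneg _)
    · have : 1 - f x / (f x - f y) = -f y * (f x - f y) / (f x - f y) ^ 2 := by
        field_simp
        ring
      have : 0 ≤ 1 - f x / (f x - f y) := by
        rw [this]
        exact div_nonneg (by nlinarith [sq_nonneg (f y)]) (sq_nonneg _)
      linarith

theorem Real.integral_two_mul_sqrt_sq_sub_sq {r d : ℝ} (hr : 0 < r) (hd : |d| ≤ r) :
    ∫ x in d..r, 2 * √(r ^ 2 - x ^ 2) = r ^ 2 * Real.arccos (d / r) - d * √(r ^ 2 - d ^ 2) := by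
  obtain ⟨hd0, hd1⟩ := abs_le.1 hd
  have hderiv : ∀ x ∈ Set.Ioo d r, HasDerivAt
      (fun x => x * √(r ^ 2 - x ^ 2) - r ^ 2 * Real.arccos (x / r)) (2 * √(r ^ 2 - x ^ 2)) x := by
    rintro x ⟨hx0, hx1⟩
    have hpos : 0 < r ^ 2 - x ^ 2 := by nlinarith
    have h1 : x / r ≠ -1 := by
      rw [Ne, div_eq_iff hr.ne']
      linarith
    have h2 : x / r ≠ 1 := by
      rw [Ne, div_eq_iff hr.ne']
      linarith
    have hs : √(1 - (x / r) ^ 2) = √(r ^ 2 - x ^ 2) / r := by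
      rw [show 1 - (x / r) ^ 2 = (r ^ 2 - x ^ 2) / r ^ 2 by field_simp,
        Real.sqrt_div hpos.le, Real.sqrt_sq hr.le]
    have hA := ((Real.hasDerivAt_arccos h1 h2).comp x ((hasDerivAt_id x).div_const r)).const_mul
      (r ^ 2)
    have hS := (hasDerivAt_id x).mul ((((hasDerivAt_id x).pow 2).const_sub (r ^ 2)).sqrt hpos.ne')
    refine (hS.sub hA).congr_deriv ?_
    have hs0 : √(r ^ 2 - x ^ 2) ≠ 0 := (Real.sqrt_pos.2 hpos).ne'
    have hsq := Real.sq_sqrt hpos.le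
    simp only [id, hs, Pi.pow_apply]
    field_simp
    simp only [hsq]
    ring
  rw [intervalIntegral.integral_eq_sub_of_hasDerivAt_of_le hd1
    (Continuous.continuousOn (by fun_prop)) hderiv
    (Continuous.intervalIntegrable (by fun_prop) _ _)]
  simp [hr.ne']

theorem measurableSet_sq_add_sq_le_inter_lt_fst (r d : ℝ) :
    MeasurableSet {p : ℝ × ℝ | p.1 ^ 2 + p.2 ^ 2 ≤ r ^ 2 ∧ d < p.1} :=
  have h1 : MeasurableSet {p : ℝ × ℝ | p.1 ^ 2 + p.2 ^ 2 ≤ r ^ 2} :=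
    measurableSet_le (by fun_prop) (by fun_prop)
  have h2 : MeasurableSet {p : ℝ × ℝ | d < p.1} := measurableSet_lt (by fun_prop) (by fun_prop)
  h1.inter h2

theorem volume_prod_sq_add_sq_le_inter_lt_fst {r d : ℝ} (hr : 0 < r) (hd : |d| ≤ r) :
    volume {p : ℝ × ℝ | p.1 ^ 2 + p.2 ^ 2 ≤ r ^ 2 ∧ d < p.1} =
      ENNReal.ofReal (r ^ 2 * Real.arccos (d / r) - d * √(r ^ 2 - d ^ 2)) := by
  have hd1 : d ≤ r := (abs_le.1 hd).2
  have hslice : ∀ x : ℝ, volume (Prod.mk x ⁻¹' {p : ℝ × ℝ | p.1 ^ 2 + p.2 ^ 2 ≤ r ^ 2 ∧ d < p.1})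
      = (Set.Ioc d r).indicator (fun x => ENNReal.ofReal (2 * √(r ^ 2 - x ^ 2))) x := by
    intro x
    by_cases hx : x ∈ Set.Ioc d r
    · have hx0 : -r < x := (abs_le.1 hd).1.trans_lt hx.1
      have : Prod.mk x ⁻¹' {p : ℝ × ℝ | p.1 ^ 2 + p.2 ^ 2 ≤ r ^ 2 ∧ d < p.1}
          = Set.Icc (-√(r ^ 2 - x ^ 2)) (√(r ^ 2 - x ^ 2)) := by
        ext y
        have hpos : 0 ≤ r ^ 2 - x ^ 2 := by nlinarith [hx.2]
        simp only [Set.mem_preimage, Set.mem_ofPred_eq, hx.1, and_true, Set.mem_Icc]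
        rw [← abs_le, Real.le_sqrt (abs_nonneg y) hpos, sq_abs, le_sub_iff_add_le']
      rw [this, Real.volume_Icc, Set.indicator_of_mem hx]
      congr 1
      ring
    · have : Prod.mk x ⁻¹' {p : ℝ × ℝ | p.1 ^ 2 + p.2 ^ 2 ≤ r ^ 2 ∧ d < p.1} = ∅ := by
        rw [Set.eq_empty_iff_forall_notMem]
        rintro y ⟨h1, h2⟩
        exact hx ⟨h2, by
          simp only at h1
          nlinarith [sq_nonneg y]⟩
      rw [this, measure_empty, Set.indicator_of_notMem hx]
  rw [Measure.volume_eq_prod, Measure.prod_apply (measurableSet_sq_add_sq_le_inter_lt_fst r d), lintegral_congr hslice,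
    lintegral_indicator measurableSet_Ioc, ← Real.integral_two_mul_sqrt_sq_sub_sq hr hd,
    intervalIntegral.integral_of_le hd1, ofReal_integral_eq_lintegral_ofReal]
  · exact (Continuous.integrableOn_Icc (by fun_prop)).mono_set Set.Ioc_subset_Icc_self
  · exact Filter.Eventually.of_forall fun x => by positivity

/-- The area of a circular segment: the part of a disc of radius `r` beyond a line at signed distance
`d` from the center, with unit normal `n`. -/
theorem EuclideanSpace.volume_closedBall_inter_lt_inner {n : EuclideanSpace ℝ (Fin 2)}
    (hn : ‖n‖ = 1) (F : EuclideanSpace ℝ (Fin 2)) {r d : ℝ} (hr : 0 < r) (hd : |d| ≤ r) :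
    volume {x : EuclideanSpace ℝ (Fin 2) | dist x F ≤ r ∧ d < inner ℝ n (x - F)} =
      ENNReal.ofReal (r ^ 2 * Real.arccos (d / r) - d * √(r ^ 2 - d ^ 2)) := by
  obtain ⟨b, hb⟩ := Orthonormal.exists_orthonormalBasis_extension_of_card_eq (𝕜 := ℝ)
    (ι := Fin 2) (E := EuclideanSpace ℝ (Fin 2)) (by simp) (v := fun _ => n) (s := {0})
    ⟨fun _ => hn, fun i j hij => (hij (Subsingleton.elim i j)).elim⟩
  have hb0 : b 0 = n := hb 0 rfl
  have hmp : MeasurePreserving (fun x : EuclideanSpace ℝ (Fin 2) =>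
      MeasurableEquiv.finTwoArrow (WithLp.ofLp (b.repr (x - F)))) volume volume :=
    (volume_preserving_finTwoArrow ℝ).comp ((PiLp.volume_preserving_ofLp (Fin 2)).comp
      (b.measurePreserving_repr.comp (measurePreserving_sub_right volume F)))
  rw [← volume_prod_sq_add_sq_le_inter_lt_fst hr hd,
    ← hmp.measure_preimage (measurableSet_sq_add_sq_le_inter_lt_fst r d).nullMeasurableSet]
  congr 1
  ext x
  have hnorm : dist x F ^ 2 = (b.repr (x - F) 0) ^ 2 + (b.repr (x - F) 1) ^ 2 := by
    rw [dist_eq_norm, ← b.repr.norm_map, EuclideanSpace.real_norm_sq_eq, Fin.sum_univ_two]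
  simp only [Set.mem_ofPred_eq, Set.mem_preimage, MeasurableEquiv.finTwoArrow_apply]
  rw [← hnorm, sq_le_sq₀ dist_nonneg hr.le, b.repr_apply_apply, hb0]

/-- In the plane, the line through `A` and `B` is a level set of `inner ℝ m`, for any nonzero `m`
orthogonal to it. -/
theorem EuclideanSpace.mem_affineSpan_pair_iff_inner_eq_zero {A B m : EuclideanSpace ℝ (Fin 2)}
    (hAB : A ≠ B) (hm : m ≠ 0) (h : inner ℝ m (B - A) = 0) (x : EuclideanSpace ℝ (Fin 2)) :
    x ∈ affineSpan ℝ {A, B} ↔ inner ℝ m (x - A) = 0 := by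
  rw [mem_affineSpan_pair_iff_exists_lineMap_eq]
  constructor
  · rintro ⟨t, rfl⟩
    simp [AffineMap.lineMap_apply, inner_smul_right, h]
  · intro hx
    have hm' : m 0 ≠ 0 ∨ m 1 ≠ 0 := by
      by_contra! hcon
      exact hm (by ext i; fin_cases i <;> simp [hcon])
    have hN : (B 0 - A 0) ^ 2 + (B 1 - A 1) ^ 2 ≠ 0 := by
      intro h0
      refine hAB ?_
      ext i
      fin_cases i
      · simp only [Fin.zero_eta]; nlinarith [sq_nonneg (B 1 - A 1)]
      · simp only [Fin.mk_one]; nlinarith [sq_nonneg (B 0 - A 0)]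
    simp only [PiLp.inner_apply, Fin.sum_univ_two, RCLike.inner_apply, conj_trivial,
      PiLp.sub_apply] at h hx
    have hdet : (x 0 - A 0) * (B 1 - A 1) = (x 1 - A 1) * (B 0 - A 0) := by
      rcases hm' with h0 | h1
      · refine mul_left_cancel₀ h0 ?_
        linear_combination (B 1 - A 1) * hx - (x 1 - A 1) * h
      · refine mul_left_cancel₀ h1 ?_
        linear_combination (x 0 - A 0) * h - (B 0 - A 0) * hx
    refine ⟨((x 0 - A 0) * (B 0 - A 0) + (x 1 - A 1) * (B 1 - A 1)) /
      ((B 0 - A 0) ^ 2 + (B 1 - A 1) ^ 2), ?_⟩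
    ext i
    fin_cases i
    · simp [AffineMap.lineMap_apply]
      field_simp
      linear_combination (-(B 1 - A 1)) * hdet
    · simp [AffineMap.lineMap_apply]
      field_simp
      linear_combination (B 0 - A 0) * hdet

theorem region_F_area
    (A B C G F : EuclideanSpace ℝ (Fin 2))
    (hC : ∠ A C B = Real.pi / 2)
    (ha : 0 < dist B C) (hb : 0 < dist A C)
    (hG : G = EuclideanGeometry.orthogonalProjection (affineSpan ℝ {A, B}) C)
    (hF : F = midpoint ℝ B C)
    (θ : ℝ) (hθ : θ = ∠ B A C) :
    volume {x : EuclideanSpace ℝ (Fin 2) |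
        dist x F ≤ dist B C / 2 ∧ (affineSpan ℝ {A, B}).SOppSide x C}
      = ENNReal.ofReal ((dist B C) ^ 2 * θ / 4
          - (dist B C) ^ 3 * dist A C / (4 * (dist A B) ^ 2)) := by
  have hpq : inner ℝ (A - C) (B - C) = 0 :=
    InnerProductGeometry.inner_eq_zero_iff_angle_eq_pi_div_two _ _ |>.2 hC
  have hcos : Real.cos θ * dist A B = dist A C := by
    rw [hθ, EuclideanGeometry.angle_comm, dist_comm A B]
    exact EuclideanGeometry.cos_angle_mul_dist_of_angle_eq_pi_div_two
      ((EuclideanGeometry.angle_comm _ _ _).trans hC)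
  have hpyth : dist A B ^ 2 = dist A C ^ 2 + dist B C ^ 2 := by
    have := (EuclideanGeometry.dist_sq_eq_dist_sq_add_dist_sq_iff_angle_eq_pi_div_two A C B).2 hC
    linarith
  have hθ0 : 0 ≤ θ := hθ ▸ EuclideanGeometry.angle_nonneg _ _ _
  have hθπ : θ ≤ Real.pi := hθ ▸ EuclideanGeometry.angle_le_pi _ _ _
  have hpp : inner ℝ (A - C) (A - C) = dist A C ^ 2 := by
    rw [real_inner_self_eq_norm_sq, dist_eq_norm]
  have hqq : inner ℝ (B - C) (B - C) = dist B C ^ 2 := by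
    rw [real_inner_self_eq_norm_sq, dist_eq_norm]
  have hc : 0 < dist A B := by
    refine lt_of_le_of_ne dist_nonneg fun h => ?_
    rw [← h] at hpyth
    nlinarith
  set a := dist B C
  set b := dist A C
  set c := dist A B
  have hqp : inner ℝ (B - C) (A - C) = 0 := by rw [real_inner_comm, hpq]
  let n : EuclideanSpace ℝ (Fin 2) := (a * b * c)⁻¹ • (a ^ 2 • (A - C) + b ^ 2 • (B - C))
  have hn_p : inner ℝ n (A - C) = a * b / c := by
    simp only [n, inner_smul_left, inner_add_left, hpp, hqp, conj_trivial]
    field_simp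
    ring
  have hn_q : inner ℝ n (B - C) = a * b / c := by
    simp only [n, inner_smul_left, inner_add_left, hqq, hpq, conj_trivial]
    field_simp
    ring
  have hn : ‖n‖ = 1 := by
    rw [← sq_eq_sq₀ (norm_nonneg _) zero_le_one, ← real_inner_self_eq_norm_sq]
    conv_lhs => rw [show n = (a * b * c)⁻¹ • (a ^ 2 • (A - C) + b ^ 2 • (B - C)) from rfl]
    rw [inner_smul_right, inner_add_right, inner_smul_right, inner_smul_right, hn_p, hn_q]
    field_simp
    linarith
  have hn0 : n ≠ 0 := norm_ne_zero_iff.1 (by rw [hn]; exact one_ne_zero)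
  have hAB : A ≠ B := dist_pos.1 hc
  have hside : ∀ x, (affineSpan ℝ {A, B}).SOppSide x C ↔ a * b / (2 * c) < inner ℝ n (x - F) := by
    intro x
    let f : EuclideanSpace ℝ (Fin 2) →ᵃ[ℝ] ℝ :=
      ((innerₗ _ n).toAffineMap).comp (AffineMap.id ℝ _ -ᵥ AffineMap.const ℝ _ A)
    have hf : ∀ y, f y = inner ℝ n (y - A) := fun y => rfl
    rw [AffineSubspace.sOppSide_iff_mul_neg_of_mem_iff f
      (EuclideanSpace.mem_affineSpan_pair_iff_inner_eq_zero hAB hn0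
        (by rw [← sub_sub_sub_cancel_right B A C, inner_sub_right, hn_p, hn_q, sub_self]))]
    have hfC : f C = -(a * b / c) := by
      rw [hf, ← neg_sub A C, inner_neg_right, hn_p]
    have hxF : inner ℝ n (x - F) = f x + a * b / (2 * c) := by
      have : x - F = (x - A) + (A - C) - (1 / 2 : ℝ) • (B - C) := by
        rw [hF, midpoint_eq_smul_add, invOf_eq_inv]
        module
      rw [this, inner_sub_right, inner_add_right, inner_smul_right, hn_p, hn_q, hf]
      field_simp
      ring
    have hpos : 0 < a * b / c := by positivity
    rw [hfC, hxF, mul_neg, neg_lt_zero, mul_pos_iff_of_pos_right hpos, lt_add_iff_pos_left]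
  have hbc : b ≤ c := by nlinarith
  have hd : |a * b / (2 * c)| ≤ a / 2 := by
    rw [abs_of_pos (by positivity), div_le_div_iff₀ (by positivity) two_pos]
    nlinarith
  simp only [hside]
  rw [EuclideanSpace.volume_closedBall_inter_lt_inner hn F (half_pos ha) hd]
  congr 1
  have hsqrt : √((a / 2) ^ 2 - (a * b / (2 * c)) ^ 2) = a ^ 2 / (2 * c) := by
    have : (a / 2) ^ 2 - (a * b / (2 * c)) ^ 2 = (a ^ 2 / (2 * c)) ^ 2 := by
      field_simp
      rw [hpyth]
      ring
    rw [this, Real.sqrt_sq (by positivity)]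
  have hdiv : a * b / (2 * c) / (a / 2) = Real.cos θ := by
    field_simp
    linarith
  rw [hsqrt, hdiv, Real.arccos_cos hθ0 hθπ]
  field_simp
  ring
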